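/- arXiv:1401.2442 — 9 statements merged into one kernel-verified Lean document; each statement's English description precedes it below -/
import Mathlib

section
/- Let r ≥ 0 and let (u, η, λ) ∈ V × H × H be a saddle point of the augmented Lagrangian L_r on V × H × H. Then Bu = η and u minimizes the functional J(v) = F(Bv) + G(v) over V, i.e., F(Bu) + G(u) ≤ F(Bv) + G(v) for all v ∈ V. -/
open scoped RealInnerProductSpace

/-- If `(u, η, lam)` is a saddle point of the augmented Lagrangian
`L_r(v, q, lam) = F q + G v + ⟪lam, Bv - q⟫ + (r/2)‖Bv - q‖²` on `V × H × H`,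
then `Bu = η` and `u` minimizes `v ↦ F (Bv) + G v` over `V`. -/
theorem saddle_point_solves_min
    {V H : Type*} [NormedAddCommGroup V] [InnerProductSpace ℝ V]
    [NormedAddCommGroup H] [InnerProductSpace ℝ H]
    (B : V →L[ℝ] H) (F : H → ℝ) (G : V → ℝ) (r : ℝ) (hr : 0 ≤ r)
    (L : V → H → H → ℝ)
    (hL : ∀ (v : V) (q lam : H),
      L v q lam = F q + G v + ⟪lam, B v - q⟫ + r / 2 * ‖B v - q‖ ^ 2)
    (u : V) (η lam : H)
    (hsaddle : (∀ μ : H, L u η μ ≤ L u η lam) ∧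
      (∀ (v : V) (q : H), L u η lam ≤ L v q lam)) :
    B u = η ∧ ∀ v : V, F (B u) + G u ≤ F (B v) + G v := by
  obtain ⟨hmax, hmin⟩ := hsaddle
  have hBu : B u = η := by
    have h := hmax (lam + (B u - η))
    rw [hL, hL, inner_add_left, real_inner_self_eq_norm_sq] at h
    have hsq : ‖B u - η‖ ^ 2 = 0 := le_antisymm (by linarith) (sq_nonneg _)
    exact sub_eq_zero.mp (norm_eq_zero.mp (pow_eq_zero_iff two_ne_zero |>.mp hsq))
  refine ⟨hBu, fun v => ?_⟩
  simpa [hL, hBu] using hmin v (B v)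
end

section
/- Assume F : H → ℝ and G : V → ℝ are convex. If (u, η, λ) ∈ V × H × H is a saddle point of L_r (r ≥ 0), then the pair (u, η) satisfies the two variational inequalities: G(v) − G(u) + ⟨λ, B(v − u)⟩ + r⟨Bu − η, B(v − u)⟩ ≥ 0 for all v ∈ V, and F(q) − F(η) − ⟨λ, q − η⟩ + r⟨η − Bu, q − η⟩ ≥ 0 for all q ∈ H. -/
open scoped RealInnerProductSpace

/-- First-order optimality condition for a convex function plus a quadratic penalty of an
affine map: a global minimizer satisfies the associated variational inequality. -/
lemma ConvexOn.variational_inequality_of_minimizer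
    {E H : Type*} [AddCommGroup E] [Module ℝ E]
    [NormedAddCommGroup H] [InnerProductSpace ℝ H]
    {f : E → ℝ} (hf : ConvexOn ℝ Set.univ f) (A : E →ₗ[ℝ] H) (w h : H) (r : ℝ) (x : E)
    (hmin : ∀ d : E, f x + ⟪w, h⟫ + r / 2 * ‖h‖ ^ 2 ≤
      f (x + d) + ⟪w, h + A d⟫ + r / 2 * ‖h + A d‖ ^ 2) (y : E) :
    0 ≤ f y - f x + ⟪w, A (y - x)⟫ + r * ⟪h, A (y - x)⟫ := by
  set a := f y - f x + ⟪w, A (y - x)⟫ + r * ⟪h, A (y - x)⟫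
  set b := r / 2 * ‖A (y - x)‖ ^ 2
  have key : ∀ t : ℝ, 0 < t → t < 1 → 0 ≤ a + t * b := by
    intro t ht ht1
    have hm := hmin (t • (y - x))
    have hc := hf.2 (Set.mem_univ x) (Set.mem_univ y) (sub_nonneg.2 ht1.le) ht.le
      (sub_add_cancel 1 t)
    have hpt : (1 - t) • x + t • y = x + t • (y - x) := by module
    rw [hpt, smul_eq_mul, smul_eq_mul] at hc
    rw [map_smul, norm_add_sq_real, inner_add_right, real_inner_smul_right,
      real_inner_smul_right, norm_smul, mul_pow, Real.norm_eq_abs, sq_abs] at hm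
    refine nonneg_of_mul_nonneg_right (a := t) ?_ ht
    simp only [a, b]
    nlinarith
  have hlim : Filter.Tendsto (fun t : ℝ => a + t * b) (nhdsWithin 0 (Set.Ioi 0)) (nhds a) := by
    have hcont : Continuous fun t : ℝ => a + t * b := by fun_prop
    simpa using (hcont.tendsto 0).mono_left nhdsWithin_le_nhds
  refine ge_of_tendsto hlim ?_
  filter_upwards [Ioo_mem_nhdsGT (zero_lt_one' ℝ)] with t ht
  exact key t ht.1 ht.2

/-- If `F` and `G` are convex and `(u, η, lam)` is a saddle point of the augmented
Lagrangian `L_r`, then `(u, η)` satisfies the two variational inequalities. -/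
theorem saddle_point_variational_inequalities
    {V H : Type*} [NormedAddCommGroup V] [InnerProductSpace ℝ V]
    [NormedAddCommGroup H] [InnerProductSpace ℝ H]
    (B : V →L[ℝ] H) (F : H → ℝ) (G : V → ℝ) (r : ℝ) (hr : 0 ≤ r)
    (hF : ConvexOn ℝ Set.univ F) (hG : ConvexOn ℝ Set.univ G)
    (L : V → H → H → ℝ)
    (hL : ∀ (v : V) (q lam : H),
      L v q lam = F q + G v + ⟪lam, B v - q⟫ + r / 2 * ‖B v - q‖ ^ 2)
    (u : V) (η lam : H)
    (hsaddle : (∀ μ : H, L u η μ ≤ L u η lam) ∧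
      (∀ (v : V) (q : H), L u η lam ≤ L v q lam)) :
    (∀ v : V, 0 ≤ G v - G u + ⟪lam, B (v - u)⟫ + r * ⟪B u - η, B (v - u)⟫) ∧
    (∀ q : H, 0 ≤ F q - F η - ⟪lam, q - η⟫ + r * ⟪η - B u, q - η⟫) := by
  constructor
  · intro v
    refine hG.variational_inequality_of_minimizer B.toLinearMap lam (B u - η) r u
      (fun d => ?_) v
    have h := hsaddle.2 (u + d) η
    rw [hL, hL, map_add, add_sub_right_comm] at h
    simp only [ContinuousLinearMap.coe_coe]
    linarith
  · intro q
    have h := hF.variational_inequality_of_minimizer (-LinearMap.id) lam (B u - η) r η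
      (fun d => ?_) q
    · simp only [LinearMap.neg_apply, LinearMap.id_apply, inner_neg_right] at h
      rw [← neg_sub (B u) η, inner_neg_left]
      linarith
    · have h := hsaddle.2 u (η + d)
      rw [hL, hL, ← sub_sub, sub_eq_add_neg (B u - η) d] at h
      simp only [LinearMap.neg_apply, LinearMap.id_apply]
      linarith
end

section
/- Assume F : H → ℝ and G : V → ℝ are convex, G is Gateaux differentiable at u with derivative G'(u) (a continuous linear functional on V), and F is Gateaux differentiable at η with derivative F'(η). If (u, η, λ) ∈ V × H × H is a saddle point of L_r (r ≥ 0), then: G'(u)(v − u) + ⟨λ, B(v − u)⟩ + r⟨Bu − η, B(v − u)⟩ ≥ 0 for all v ∈ V, and F'(η)(q − η) − ⟨λ, q − η⟩ + r⟨η − Bu, q − η⟩ ≥ 0 for all q ∈ H. -/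
open scoped RealInnerProductSpace
open Topology Filter

/-- If `φ t + a t + b t²` is nonnegative for every `t` and `φ t / t → d` as `t → 0`,
then `d + a` is nonnegative. -/
theorem add_nonneg_of_tendsto_div_of_forall_nonneg {φ : ℝ → ℝ} {a b d : ℝ}
    (hφ : Tendsto (fun t : ℝ => φ t / t) (𝓝[≠] (0 : ℝ)) (𝓝 d))
    (h : ∀ t : ℝ, 0 ≤ φ t + t * a + t ^ 2 * b) : 0 ≤ d + a := by
  have hb : Tendsto (fun t : ℝ => a + t * b) (𝓝[>] (0 : ℝ)) (𝓝 a) := by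
    have hc : Continuous fun t : ℝ => a + t * b := by fun_prop
    simpa using (hc.tendsto 0).mono_left nhdsWithin_le_nhds
  have hlim := (hφ.mono_left (nhdsGT_le_nhdsNE (0 : ℝ))).add hb
  refine ge_of_tendsto hlim ?_
  filter_upwards [self_mem_nhdsWithin] with t (ht : 0 < t)
  have heq : φ t / t + (a + t * b) = (φ t + t * a + t ^ 2 * b) / t := by
    field_simp
    ring
  rw [heq]
  exact div_nonneg (h t) ht.le

/-- Expansion of `‖x + t • y‖²` as a quadratic polynomial in `t`. -/
theorem norm_add_smul_sq {E : Type*} [NormedAddCommGroup E] [InnerProductSpace ℝ E]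
    (x y : E) (t : ℝ) :
    ‖x + t • y‖ ^ 2 = ‖x‖ ^ 2 + 2 * t * ⟪x, y⟫ + t ^ 2 * ‖y‖ ^ 2 := by
  rw [norm_add_sq_real, real_inner_smul_right, norm_smul, mul_pow, Real.norm_eq_abs, sq_abs]
  ring

/-- If `F` and `G` are convex and Gateaux differentiable (at `η` and `u` respectively)
and `(u, η, lam)` is a saddle point of the augmented Lagrangian `L_r`, then `(u, η)`
satisfies the variational inequalities written with the Gateaux derivatives. -/
theorem saddle_point_variational_inequalities_differentiable
    {V H : Type*} [NormedAddCommGroup V] [InnerProductSpace ℝ V]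
    [NormedAddCommGroup H] [InnerProductSpace ℝ H]
    (B : V →L[ℝ] H) (F : H → ℝ) (G : V → ℝ) (r : ℝ) (hr : 0 ≤ r)
    (hF : ConvexOn ℝ Set.univ F) (hG : ConvexOn ℝ Set.univ G)
    (L : V → H → H → ℝ)
    (hL : ∀ (v : V) (q lam : H),
      L v q lam = F q + G v + ⟪lam, B v - q⟫ + r / 2 * ‖B v - q‖ ^ 2)
    (u : V) (η lam : H)
    (G' : V →L[ℝ] ℝ) (F' : H →L[ℝ] ℝ)
    (hG' : ∀ w : V, Tendsto (fun t : ℝ => (G (u + t • w) - G u) / t)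
      (𝓝[≠] (0 : ℝ)) (𝓝 (G' w)))
    (hF' : ∀ w : H, Tendsto (fun t : ℝ => (F (η + t • w) - F η) / t)
      (𝓝[≠] (0 : ℝ)) (𝓝 (F' w)))
    (hsaddle : (∀ μ : H, L u η μ ≤ L u η lam) ∧
      (∀ (v : V) (q : H), L u η lam ≤ L v q lam)) :
    (∀ v : V, 0 ≤ G' (v - u) + ⟪lam, B (v - u)⟫ + r * ⟪B u - η, B (v - u)⟫) ∧
    (∀ q : H, 0 ≤ F' (q - η) - ⟪lam, q - η⟫ + r * ⟪η - B u, q - η⟫) := by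
  constructor
  · intro v
    rw [add_assoc]
    refine add_nonneg_of_tendsto_div_of_forall_nonneg (hG' (v - u))
      (b := r / 2 * ‖B (v - u)‖ ^ 2) fun t => ?_
    have hmin := hsaddle.2 (u + t • (v - u)) η
    have hB : B (u + t • (v - u)) - η = (B u - η) + t • B (v - u) := by
      rw [map_add, map_smul]
      abel
    rw [hL, hL, hB, norm_add_smul_sq, inner_add_right, real_inner_smul_right] at hmin
    linarith
  · intro q
    rw [sub_eq_add_neg, add_assoc]
    refine add_nonneg_of_tendsto_div_of_forall_nonneg (hF' (q - η))
      (b := r / 2 * ‖q - η‖ ^ 2) fun t => ?_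
    have hmin := hsaddle.2 u (η + t • (q - η))
    have hB : B u - (η + t • (q - η)) = (B u - η) + t • (-(q - η)) := by
      rw [smul_neg]
      abel
    rw [hL, hL, hB, norm_add_smul_sq, inner_add_right, real_inner_smul_right,
      inner_neg_right, inner_neg_right, norm_neg] at hmin
    have hswap : ⟪η - B u, q - η⟫ = -⟪B u - η, q - η⟫ := by
      rw [← inner_neg_left, neg_sub]
    rw [hswap]
    linarith
end

section
/- Let r > 0 and α > 0. Assume G : V → ℝ is Gateaux differentiable at every point with derivative map G', and G' is strongly monotone: (G'(x) − G'(y))(x − y) ≥ α‖x − y‖² for all x, y ∈ V. Suppose u ∈ V and η, λ ∈ H satisfy G'(u)(v − u) + ⟨λ, B(v − u)⟩ + r⟨Bu − η, B(v − u)⟩ ≥ 0 for all v ∈ V, and suppose sequences uⁿ ∈ V, ηⁿ, λⁿ ∈ H satisfy, for every n, G'(uⁿ)(v − uⁿ) + ⟨λⁿ, B(v − uⁿ)⟩ + r⟨Buⁿ − ηⁿ, B(v − uⁿ)⟩ ≥ 0 for all v ∈ V. If Buⁿ → Bu in H, ηⁿ → η in H, and (λⁿ) is bounded in H, then (G'(uⁿ)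 − G'(u))(uⁿ − u) → 0 and uⁿ → u in V. -/
open scoped RealInnerProductSpace
open Topology Filter

/-- Key convergence step in the proof of convergence of Algorithm 1 of the
decomposition–coordination method: strong monotonicity of `G'` replaces
injectivity of `B`. -/
theorem algorithm_one_convergence
    {V H : Type*} [NormedAddCommGroup V] [InnerProductSpace ℝ V]
    [NormedAddCommGroup H] [InnerProductSpace ℝ H]
    (B : V →L[ℝ] H) (G : V → ℝ) (r α : ℝ) (hr : 0 < r) (hα : 0 < α)
    (G' : V → V →L[ℝ] ℝ)
    (hGateaux : ∀ x w : V, Tendsto (fun t : ℝ => (G (x + t • w) - G x) / t)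
      (𝓝[≠] (0 : ℝ)) (𝓝 (G' x w)))
    (hmono : ∀ x y : V, α * ‖x - y‖ ^ 2 ≤ (G' x - G' y) (x - y))
    (u : V) (η lam : H)
    (hu : ∀ v : V,
      0 ≤ G' u (v - u) + ⟪lam, B (v - u)⟫ + r * ⟪B u - η, B (v - u)⟫)
    (useq : ℕ → V) (ηseq lamseq : ℕ → H)
    (hseq : ∀ (n : ℕ) (v : V),
      0 ≤ G' (useq n) (v - useq n) + ⟪lamseq n, B (v - useq n)⟫ +
        r * ⟪B (useq n) - ηseq n, B (v - useq n)⟫)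
    (hBu : Tendsto (fun n => B (useq n)) atTop (𝓝 (B u)))
    (hη : Tendsto ηseq atTop (𝓝 η))
    (hlam : ∃ C : ℝ, ∀ n : ℕ, ‖lamseq n‖ ≤ C) :
    Tendsto (fun n => (G' (useq n) - G' u) (useq n - u)) atTop (𝓝 0) ∧
    Tendsto useq atTop (𝓝 u) := by
  obtain ⟨C, hC⟩ := hlam
  have hd : Tendsto (fun n => ‖B (useq n) - B u‖) atTop (𝓝 0) :=
    tendsto_iff_norm_sub_tendsto_zero.1 hBu
  have he : Tendsto (fun n => ‖(B u - η) - (B (useq n) - ηseq n)‖) atTop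
      (𝓝 ‖(B u - η) - (B u - η)‖) :=
    (tendsto_const_nhds.sub (hBu.sub hη)).norm
  have hbound : Tendsto (fun n => ((‖lam‖ + C) + r * ‖(B u - η) - (B (useq n) - ηseq n)‖) *
      ‖B (useq n) - B u‖) atTop (𝓝 0) := by
    simpa using (tendsto_const_nhds.add (he.const_mul r)).mul hd
  have hle : ∀ n, (G' (useq n) - G' u) (useq n - u) ≤
      ((‖lam‖ + C) + r * ‖(B u - η) - (B (useq n) - ηseq n)‖) * ‖B (useq n) - B u‖ := by
    intro n
    have hsum : (G' (useq n) - G' u) (useq n - u) ≤ ⟪lam - lamseq n, B (useq n) - B u⟫ +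
        r * ⟪(B u - η) - (B (useq n) - ηseq n), B (useq n) - B u⟫ := by
      have h₁ := hu (useq n)
      have h₂ := hseq n u
      simp only [map_sub, inner_sub_left, inner_sub_right, sub_apply] at h₁ h₂ ⊢
      linarith
    have hlam_le : ⟪lam - lamseq n, B (useq n) - B u⟫ ≤ (‖lam‖ + C) * ‖B (useq n) - B u‖ :=
      (real_inner_le_norm _ _).trans <| by
        gcongr
        exact (norm_sub_le _ _).trans (by linarith [hC n])
    have hres_le := mul_le_mul_of_nonneg_left
      (real_inner_le_norm ((B u - η) - (B (useq n) - ηseq n)) (B (useq n) - B u)) hr.le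
    linarith
  have hlim : Tendsto (fun n => (G' (useq n) - G' u) (useq n - u)) atTop (𝓝 0) :=
    squeeze_zero (fun n => (by positivity : 0 ≤ α * ‖useq n - u‖ ^ 2).trans (hmono _ _)) hle hbound
  refine ⟨hlim, tendsto_iff_norm_sub_tendsto_zero.2 ?_⟩
  have hsq : Tendsto (fun n => ‖useq n - u‖ ^ 2) atTop (𝓝 0) := by
    refine squeeze_zero (fun n => by positivity) (fun n => ?_)
      (zero_div α ▸ hlim.div_const α)
    rw [le_div_iff₀' hα]
    exact hmono _ _
  simpa using hsq.sqrt
end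

section
/- Let r > 0 and α > 0. Assume G : V → ℝ is Gateaux differentiable at every point with derivative map G', and G' is strongly monotone: (G'(x) − G'(y))(x − y) ≥ α‖x − y‖² for all x, y ∈ V. Suppose u ∈ V and η, λ ∈ H satisfy G'(u)(v − u) + ⟨λ, B(v − u)⟩ + r⟨Bu − η, B(v − u)⟩ ≥ 0 for all v ∈ V, and suppose η⁰ ∈ H and sequences uⁿ ∈ V, ηⁿ, λⁿ ∈ H (n ≥ 1) satisfy, for every n ≥ 1, G'(uⁿ)(v − uⁿ) + ⟨λⁿ, B(v − uⁿ)⟩ + r⟨Buⁿ − ηⁿ⁻¹, B(v − uⁿ)⟩ ≥ 0 for all v ∈ V. If Buⁿ → Bu in H, ηⁿ → η in H, and (λⁿ) is bounded in H, then (G'(uⁿ) − G'(u))(uⁿ − u) → 0 and uⁿ → u in V. -/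
open scoped RealInnerProductSpace
open Topology Filter

/-- Key convergence step in the proof of convergence of Algorithm 2 (the uncoupled
decomposition–coordination algorithm), in which the variational inequality for `uⁿ`
involves the previous iterate `ηⁿ⁻¹`; strong monotonicity of `G'` replaces
injectivity of `B`. -/
theorem algorithm_two_convergence
    {V H : Type*} [NormedAddCommGroup V] [InnerProductSpace ℝ V]
    [NormedAddCommGroup H] [InnerProductSpace ℝ H]
    (B : V →L[ℝ] H) (G : V → ℝ) (r α : ℝ) (hr : 0 < r) (hα : 0 < α)
    (G' : V → V →L[ℝ] ℝ)
    (hGateaux : ∀ x w : V, Tendsto (fun t : ℝ => (G (x + t • w) - G x) / t)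
      (𝓝[≠] (0 : ℝ)) (𝓝 (G' x w)))
    (hmono : ∀ x y : V, α * ‖x - y‖ ^ 2 ≤ (G' x - G' y) (x - y))
    (u : V) (η lam : H)
    (hu : ∀ v : V,
      0 ≤ G' u (v - u) + ⟪lam, B (v - u)⟫ + r * ⟪B u - η, B (v - u)⟫)
    (useq : ℕ → V) (ηseq lamseq : ℕ → H)
    (hseq : ∀ n : ℕ, 1 ≤ n → ∀ v : V,
      0 ≤ G' (useq n) (v - useq n) + ⟪lamseq n, B (v - useq n)⟫ +
        r * ⟪B (useq n) - ηseq (n - 1), B (v - useq n)⟫)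
    (hBu : Tendsto (fun n => B (useq n)) atTop (𝓝 (B u)))
    (hη : Tendsto ηseq atTop (𝓝 η))
    (hlam : ∃ C : ℝ, ∀ n : ℕ, ‖lamseq n‖ ≤ C) :
    Tendsto (fun n => (G' (useq n) - G' u) (useq n - u)) atTop (𝓝 0) ∧
    Tendsto useq atTop (𝓝 u) := by
  obtain ⟨C, hC⟩ := hlam
  have hd : Tendsto (fun n => B (useq n) - B u) atTop (𝓝 0) := by
    simpa using hBu.sub_const (B u)
  have hηpred : Tendsto (fun n => ηseq (n - 1)) atTop (𝓝 η) :=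
    hη.comp (tendsto_sub_atTop_nat 1)
  have hbound : Tendsto (fun n => (‖lam‖ + C) * ‖B (useq n) - B u‖ +
      r * ⟪(B u - η) - (B (useq n) - ηseq (n - 1)), B (useq n) - B u⟫) atTop (𝓝 0) := by
    have h₁ := hd.norm.const_mul (‖lam‖ + C)
    have h₂ := (((hBu.sub hηpred).const_sub (B u - η)).inner (𝕜 := ℝ) hd).const_mul r
    simpa using h₁.add h₂
  have hG : Tendsto (fun n => (G' (useq n) - G' u) (useq n - u)) atTop (𝓝 0) := by
    refine tendsto_of_tendsto_of_tendsto_of_le_of_le' tendsto_const_nhds hbound ?_ ?_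
    · exact Eventually.of_forall fun n => le_trans (by positivity) (hmono (useq n) u)
    · filter_upwards [eventually_ge_atTop 1] with n hn
      have h₁ := hu (useq n)
      have h₂ := hseq n hn u
      have h₃ : ⟪lam - lamseq n, B (useq n) - B u⟫ ≤ (‖lam‖ + C) * ‖B (useq n) - B u‖ := by
        refine (real_inner_le_norm _ _).trans ?_
        gcongr
        exact (norm_sub_le _ _).trans (by gcongr; exact hC n)
      rw [← neg_sub (useq n) u] at h₂
      simp only [map_neg, inner_neg_right] at h₂
      rw [map_sub B] at h₁ h₂
      rw [inner_sub_left] at h₃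
      rw [inner_sub_left (B u - η), sub_apply]
      linarith
  refine ⟨hG, ?_⟩
  have hsq : Tendsto (fun n => ‖useq n - u‖ ^ 2) atTop (𝓝 0) := by
    refine squeeze_zero (fun n => by positivity) (fun n => ?_)
      (by simpa using hG.div_const α)
    rw [le_div_iff₀' hα]
    simpa using hmono (useq n) u
  rw [tendsto_iff_norm_sub_tendsto_zero]
  simpa using hsq.sqrt
end

section
/- Assume 1 < p₁ ≤ p(x) ≤ p₂ < ∞ a.e. Let F and F_n (n ∈ ℕ) be measurable functions on Ω with ρ_{p(·)}(F) < ∞ and ρ_{p(·)}(F_n) < ∞ for every n. If F_n converges weakly to F in L^{p(·)}(Ω), then ρ_{p(·)}(F) ≤ liminf_{n→∞} ρ_{p(·)}(F_n). -/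
open MeasureTheory Filter Topology
open scoped ENNReal

/-- The absolute value of the derivative of `t ↦ |t| ^ q`. -/
theorem abs_mul_rpow_sub_two_mul {q : ℝ} (hq : 1 < q) (a : ℝ) :
    |q * |a| ^ (q - 2) * a| = q * |a| ^ (q - 1) := by
  rw [abs_mul, abs_mul, abs_of_pos (by linarith : 0 < q),
    abs_of_nonneg (Real.rpow_nonneg (abs_nonneg a) _)]
  rcases eq_or_ne a 0 with rfl | ha
  · simp [Real.zero_rpow (by linarith : q - 1 ≠ 0)]
  · rw [mul_assoc, ← Real.rpow_add_one (abs_pos.2 ha).ne']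
    ring_nf

theorem mul_rpow_sub_two_mul_self {q : ℝ} (hq : 1 < q) (a : ℝ) :
    a * (q * |a| ^ (q - 2) * a) = q * |a| ^ q := by
  rcases eq_or_ne a 0 with rfl | ha
  · simp [Real.zero_rpow (by linarith : q ≠ 0)]
  · have h : |a| ^ q = |a| ^ (q - 2) * |a| ^ 2 := by
      rw [← Real.rpow_add_natCast (abs_pos.2 ha).ne']
      norm_num
    rw [h, sq_abs]
    ring

/-- The graph of `t ↦ |t| ^ q` lies above its tangent lines. -/
theorem abs_rpow_add_tangent_le {q : ℝ} (hq : 1 < q) (a b : ℝ) :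
    |a| ^ q + (b * (q * |a| ^ (q - 2) * a) - a * (q * |a| ^ (q - 2) * a)) ≤ |b| ^ q := by
  have hq0 : 0 < q := by linarith
  have hq1 : 0 < q - 1 := by linarith
  have hY := Real.young_inequality_of_nonneg (abs_nonneg b)
    (Real.rpow_nonneg (abs_nonneg a) (q - 1)) (Real.HolderConjugate.conjExponent hq)
  rw [← Real.rpow_mul (abs_nonneg a), Real.conjExponent,
    mul_div_cancel₀ _ hq1.ne'] at hY
  have hb : b * (q * |a| ^ (q - 2) * a) ≤ |b| * (q * |a| ^ (q - 1)) := by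
    rw [← abs_mul_rpow_sub_two_mul hq a, ← abs_mul]
    exact le_abs_self _
  have hY' : |b| * (q * |a| ^ (q - 1)) ≤ |b| ^ q + (q - 1) * |a| ^ q := by
    have h := mul_le_mul_of_nonneg_left hY hq0.le
    have e : q * (|b| ^ q / q + |a| ^ q / (q / (q - 1))) = |b| ^ q + (q - 1) * |a| ^ q := by
      field_simp
    linarith
  rw [mul_rpow_sub_two_mul_self hq]
  linarith

/-- The conjugate power of the derivative of `t ↦ |t| ^ q` is controlled by `|t| ^ q`, uniformly
for exponents `q` in a compact subinterval of `(1, ∞)`. -/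
theorem abs_rpow_conjExponent_le {q p₁ p₂ : ℝ} (hp₁ : 1 < p₁) (h₁ : p₁ ≤ q) (h₂ : q ≤ p₂)
    (a : ℝ) :
    |q * |a| ^ (q - 2) * a| ^ (q / (q - 1)) ≤ p₂ ^ (p₁ / (p₁ - 1)) * |a| ^ q := by
  have hq : 1 < q := by linarith
  have hq1 : 0 < q - 1 := by linarith
  have hp1 : 0 < p₁ - 1 := by linarith
  rw [abs_mul_rpow_sub_two_mul hq, Real.mul_rpow (by linarith) (by positivity),
    ← Real.rpow_mul (abs_nonneg a), mul_div_cancel₀ _ hq1.ne']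
  gcongr
  calc q ^ (q / (q - 1)) ≤ p₂ ^ (q / (q - 1)) := by gcongr
    _ ≤ p₂ ^ (p₁ / (p₁ - 1)) := by
      apply Real.rpow_le_rpow_of_exponent_le (by linarith)
      rw [div_le_div_iff₀ hq1 hp1]
      linarith

theorem integrable_of_nonneg_of_lintegral_ofReal_lt_top {Ω : Type*} [MeasurableSpace Ω]
    {μ : Measure Ω} {f : Ω → ℝ} (hf : Measurable f) (hf0 : 0 ≤ f)
    (h : ∫⁻ x, ENNReal.ofReal (f x) ∂μ < ⊤) : Integrable f μ :=
  ⟨hf.aestronglyMeasurable, (hasFiniteIntegral_iff_ofReal (Eventually.of_forall hf0)).2 h⟩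

/-- Weak lower semicontinuity of the modular: if `F_n ⇀ F` weakly in `L^{p(·)}(Ω)`
then `ρ_{p(·)}(F) ≤ liminf ρ_{p(·)}(F_n)`. -/
theorem modular_weak_lower_semicontinuous
    {Ω : Type*} [MeasurableSpace Ω] (μ : Measure Ω)
    (p : Ω → ℝ) (hp : Measurable p) (p₁ p₂ : ℝ) (hp₁ : 1 < p₁)
    (hbd : ∀ᵐ x ∂μ, p₁ ≤ p x ∧ p x ≤ p₂)
    (F : Ω → ℝ) (hF : Measurable F)
    (hFfin : ∫⁻ x, ENNReal.ofReal (|F x| ^ p x) ∂μ < ⊤)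
    (Fn : ℕ → Ω → ℝ) (hFn : ∀ n, Measurable (Fn n))
    (hFnfin : ∀ n, ∫⁻ x, ENNReal.ofReal (|Fn n x| ^ p x) ∂μ < ⊤)
    (hweak : ∀ g : Ω → ℝ, Measurable g →
      ∫⁻ x, ENNReal.ofReal (|g x| ^ (p x / (p x - 1))) ∂μ < ⊤ →
      Tendsto (fun n => ∫ x, Fn n x * g x ∂μ) atTop (𝓝 (∫ x, F x * g x ∂μ))) :
    ∫⁻ x, ENNReal.ofReal (|F x| ^ p x) ∂μ ≤
      atTop.liminf (fun n => ∫⁻ x, ENNReal.ofReal (|Fn n x| ^ p x) ∂μ) := by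
  set g : Ω → ℝ := fun x => p x * |F x| ^ (p x - 2) * F x
  have hgm : Measurable g := by fun_prop
  have integrable_modular : ∀ u : Ω → ℝ, Measurable u →
      ∫⁻ x, ENNReal.ofReal (|u x| ^ p x) ∂μ < ⊤ → Integrable (fun x => |u x| ^ p x) μ :=
    fun u hu h => integrable_of_nonneg_of_lintegral_ofReal_lt_top (by fun_prop)
      (fun x => Real.rpow_nonneg (abs_nonneg _) _) h
  have hFi := integrable_modular F hF hFfin
  have hgi : Integrable (fun x => |g x| ^ (p x / (p x - 1))) μ := by
    refine (hFi.const_mul (p₂ ^ (p₁ / (p₁ - 1)))).mono'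
      (Measurable.aestronglyMeasurable (by fun_prop)) ?_
    filter_upwards [hbd] with x hx
    rw [Real.norm_of_nonneg (Real.rpow_nonneg (abs_nonneg _) _)]
    exact abs_rpow_conjExponent_le hp₁ hx.1 hx.2 (F x)
  have integrable_mul : ∀ u : Ω → ℝ, Measurable u →
      Integrable (fun x => |u x| ^ p x) μ → Integrable (fun x => u x * g x) μ := by
    intro u hu hui
    refine (hui.add hgi).mono' (Measurable.aestronglyMeasurable (by fun_prop)) ?_
    filter_upwards [hbd] with x hx
    have hq : 1 < p x := hp₁.trans_le hx.1
    have hc := Real.HolderConjugate.conjExponent hq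
    rw [Real.norm_eq_abs, abs_mul]
    refine (Real.young_inequality_of_nonneg (abs_nonneg (u x)) (abs_nonneg (g x)) hc).trans ?_
    exact add_le_add (div_le_self (Real.rpow_nonneg (abs_nonneg _) _) hc.lt.le)
      (div_le_self (Real.rpow_nonneg (abs_nonneg _) _) hc.symm.lt.le)
  have hlim : Tendsto (fun n => ENNReal.ofReal ((∫ x, |F x| ^ p x ∂μ) +
      ((∫ x, Fn n x * g x ∂μ) - ∫ x, F x * g x ∂μ))) atTop
      (𝓝 (∫⁻ x, ENNReal.ofReal (|F x| ^ p x) ∂μ)) := by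
    rw [← ofReal_integral_eq_lintegral_ofReal hFi
      (Eventually.of_forall fun x => Real.rpow_nonneg (abs_nonneg _) _)]
    refine ENNReal.tendsto_ofReal ?_
    have h := hweak g hgm ((hasFiniteIntegral_iff_ofReal
      (Eventually.of_forall fun x => Real.rpow_nonneg (abs_nonneg _) _)).1 hgi.2)
    simpa using (h.sub_const (∫ x, F x * g x ∂μ)).const_add (∫ x, |F x| ^ p x ∂μ)
  rw [← hlim.liminf_eq]
  refine liminf_le_liminf (Eventually.of_forall fun n => ?_)
  have hni := integrable_modular (Fn n) (hFn n) (hFnfin n)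
  have hFg := integrable_mul F hF hFi
  have hng := integrable_mul (Fn n) (hFn n) hni
  have hsub : Integrable (fun x => Fn n x * g x - F x * g x) μ := hng.sub hFg
  rw [← ofReal_integral_eq_lintegral_ofReal hni
    (Eventually.of_forall fun x => Real.rpow_nonneg (abs_nonneg _) _),
    ← integral_sub hng hFg, ← integral_add hFi hsub]
  refine ENNReal.ofReal_le_ofReal (integral_mono_ae (hFi.add hsub) hni ?_)
  filter_upwards [hbd] with x hx
  exact abs_rpow_add_tangent_le (hp₁.trans_le hx.1) (F x) (Fn n x)
end

section
/- Assume 1 < p₁ ≤ p(x) ≤ p₂ < ∞ a.e. Let F and F_n (n ∈ ℕ) be measurable functions on Ω with ρ_{p(·)}(F) < ∞ and ρ_{p(·)}(F_n) < ∞ for every n. If F_n converges weakly to F in L^{p(·)}(Ω) and ρ_{p(·)}(F_n) → ρ_{p(·)}(F), then ρ_{p(·)}(F_n − F) → 0, i.e., F_n → F strongly in L^{p(·)}(Ω). -/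
open MeasureTheory Filter Topology
open scoped ENNReal

/-- The function `t ↦ |t| ^ p` is strictly midpoint convex for `1 < p`. -/
lemma abs_half_add_rpow_lt {a b p : ℝ} (hp : 1 < p) (hab : a ≠ b) :
    2 * |(a + b) / 2| ^ p < |a| ^ p + |b| ^ p := by
  have hp0 : 0 < p := by linarith
  by_cases h : |a| = |b|
  · rcases abs_eq_abs.1 h with h | h
    · exact absurd h hab
    · have hb : b ≠ 0 := by
        rintro rfl
        exact hab (by simpa using h)
      have hbp : 0 < |b| ^ p := Real.rpow_pos_of_pos (abs_pos.2 hb) p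
      subst h
      simp [Real.zero_rpow hp0.ne', hbp]
  · have hconv := (strictConvexOn_rpow hp).2 (Set.mem_Ici.2 (abs_nonneg a))
      (Set.mem_Ici.2 (abs_nonneg b)) h (by norm_num : (0 : ℝ) < 1 / 2)
      (by norm_num : (0 : ℝ) < 1 / 2) (by norm_num)
    simp only [smul_eq_mul] at hconv
    have hle : |(a + b) / 2| ≤ 1 / 2 * |a| + 1 / 2 * |b| := by
      rw [abs_div, abs_two]
      linarith [abs_add_le a b]
    have := Real.rpow_le_rpow (abs_nonneg _) hle hp0.le
    linarith

/-- Uniform convexity of `t ↦ |t| ^ p`, uniformly for `p` in a compact subinterval of `(1, ∞)`. -/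
lemma exists_abs_sub_rpow_le {p₁ p₂ ε : ℝ} (hp₁ : 1 < p₁) (hε : 0 < ε) :
    ∃ C : ℝ, 0 ≤ C ∧ ∀ a b p : ℝ, p₁ ≤ p → p ≤ p₂ →
      |a - b| ^ p ≤ ε * (|a| ^ p + |b| ^ p) +
        C * (|a| ^ p + |b| ^ p - 2 * |(a + b) / 2| ^ p) := by
  have hcont : ∀ f : ℝ × ℝ × ℝ → ℝ, Continuous f →
      Continuous fun q : ℝ × ℝ × ℝ => |f q| ^ max q.2.2 p₁ := by
    intro f hf
    refine hf.abs.rpow (by fun_prop) fun q => Or.inr ?_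
    exact lt_of_lt_of_le (by linarith) (le_max_right _ _)
  have hA := hcont (fun q => q.1) (by fun_prop)
  have hB := hcont (fun q => q.2.1) (by fun_prop)
  have hM := hcont (fun q => (q.1 + q.2.1) / 2) (by fun_prop)
  have hS := hcont (fun q => q.1 - q.2.1) (by fun_prop)
  set K : Set (ℝ × ℝ × ℝ) :=
    {q | max |q.1| |q.2.1| = 1 ∧ (p₁ ≤ q.2.2 ∧ q.2.2 ≤ p₂) ∧
      ε * (|q.1| ^ max q.2.2 p₁ + |q.2.1| ^ max q.2.2 p₁) ≤ |q.1 - q.2.1| ^ max q.2.2 p₁} with hK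
  have hKc : IsCompact K := by
    refine IsCompact.of_isClosed_subset
      ((isCompact_Icc (a := (-1 : ℝ)) (b := 1)).prod
        ((isCompact_Icc (a := (-1 : ℝ)) (b := 1)).prod (isCompact_Icc (a := p₁) (b := p₂)))) ?_ ?_
    · refine IsClosed.inter (isClosed_eq (by fun_prop) continuous_const)
        (IsClosed.inter (IsClosed.inter (isClosed_le continuous_const continuous_snd.snd)
          (isClosed_le continuous_snd.snd continuous_const)) (isClosed_le ?_ hS))
      exact continuous_const.mul (hA.add hB)
    · rintro ⟨a, b, p⟩ ⟨h1, h2, -⟩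
      exact ⟨abs_le.1 (h1 ▸ le_max_left _ _), abs_le.1 (h1 ▸ le_max_right _ _), h2⟩
  have hquot : ContinuousOn (fun q : ℝ × ℝ × ℝ => |q.1 - q.2.1| ^ max q.2.2 p₁ /
      (|q.1| ^ max q.2.2 p₁ + |q.2.1| ^ max q.2.2 p₁ -
        2 * |(q.1 + q.2.1) / 2| ^ max q.2.2 p₁)) K := by
    refine hS.continuousOn.div ((hA.add hB).sub (continuous_const.mul hM)).continuousOn ?_
    rintro ⟨a, b, p⟩ ⟨h1, h2, h3⟩
    have hmax : max p p₁ = p := max_eq_left h2.1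
    simp only [hmax] at h3 ⊢
    have hab : a ≠ b := by
      rintro rfl
      have ha : 0 < |a| := by simp only [max_self] at h1; linarith
      have : 0 < |a| ^ p := Real.rpow_pos_of_pos ha p
      rw [sub_self, abs_zero, Real.zero_rpow (by linarith [h2.1] : p ≠ 0)] at h3
      nlinarith
    linarith [abs_half_add_rpow_lt (lt_of_lt_of_le hp₁ h2.1) hab]
  obtain ⟨C, hC⟩ := hKc.bddAbove_image hquot
  refine ⟨max C 0, le_max_right _ _, fun a b p h1 h2 => ?_⟩
  have hp : 1 < p := by linarith
  have hp0 : p ≠ 0 := by linarith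
  have hconv : ∀ a b : ℝ, 0 ≤ |a| ^ p + |b| ^ p - 2 * |(a + b) / 2| ^ p := by
    intro a b
    rcases eq_or_ne a b with rfl | hab
    · simp only [add_self_div_two]; linarith
    · linarith [abs_half_add_rpow_lt hp hab]
  have hunit : ∀ a b : ℝ, max |a| |b| = 1 →
      |a - b| ^ p ≤ ε * (|a| ^ p + |b| ^ p) +
        max C 0 * (|a| ^ p + |b| ^ p - 2 * |(a + b) / 2| ^ p) := by
    intro a b hab
    rcases le_total (|a - b| ^ p) (ε * (|a| ^ p + |b| ^ p)) with h | h
    · have := mul_nonneg (le_max_right C 0) (hconv a b)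
      linarith
    · have hmem : (a, b, p) ∈ K := by
        refine ⟨hab, ⟨h1, h2⟩, ?_⟩
        simpa only [max_eq_left h1] using h
      have hle := hC (Set.mem_image_of_mem _ hmem)
      simp only [max_eq_left h1] at hle
      have hne : a ≠ b := by
        rintro rfl
        have ha : 0 < |a| := by simp only [max_self] at hab; linarith
        have : 0 < |a| ^ p := Real.rpow_pos_of_pos ha p
        rw [sub_self, abs_zero, Real.zero_rpow hp0] at h
        nlinarith
      have hpos : 0 < |a| ^ p + |b| ^ p - 2 * |(a + b) / 2| ^ p := by
        linarith [abs_half_add_rpow_lt hp hne]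
      rw [div_le_iff₀ hpos] at hle
      have h4 := mul_le_mul_of_nonneg_right (le_max_left C 0) hpos.le
      have h5 : 0 ≤ ε * (|a| ^ p + |b| ^ p) := by positivity
      linarith
  rcases (le_max_of_le_left (abs_nonneg a) : 0 ≤ max |a| |b|).eq_or_lt with h0 | hpos
  · have ha : a = 0 := abs_nonpos_iff.1 (h0 ▸ le_max_left _ _)
    have hb : b = 0 := abs_nonpos_iff.1 (h0 ▸ le_max_right _ _)
    subst ha hb
    simp [Real.zero_rpow hp0]
  · set R := max |a| |b| with hR
    have hscale : ∀ x : ℝ, |x / R| ^ p = |x| ^ p / R ^ p := fun x => by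
      rw [abs_div, abs_of_pos hpos, Real.div_rpow (abs_nonneg _) hpos.le]
    have hRp : 0 < R ^ p := Real.rpow_pos_of_pos hpos p
    have := hunit (a / R) (b / R) (by
      rw [abs_div, abs_div, abs_of_pos hpos, max_div_div_right hpos.le, ← hR,
        div_self hpos.ne'])
    rw [← sub_div, ← add_div, div_right_comm, hscale, hscale, hscale, hscale] at this
    have h6 := mul_le_mul_of_nonneg_right this hRp.le
    field_simp at h6
    linarith

/-- Young's inequality in the form `p s t ^ (p - 1) ≤ s ^ p + (p - 1) t ^ p`. -/
lemma mul_mul_rpow_sub_one_le {p s t : ℝ} (hp : 1 < p) (hs : 0 ≤ s) (ht : 0 ≤ t) :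
    p * (s * t ^ (p - 1)) ≤ s ^ p + (p - 1) * t ^ p := by
  have hp0 : 0 < p := by linarith
  have hp1 : p - 1 ≠ 0 := by linarith
  have h := Real.young_inequality_of_nonneg hs (Real.rpow_nonneg ht (p - 1))
    (Real.HolderConjugate.conjExponent hp)
  rw [Real.conjExponent, ← Real.rpow_mul ht, mul_div_cancel₀ _ hp1] at h
  have h' := mul_le_mul_of_nonneg_left h hp0.le
  refine h'.trans_eq ?_
  field_simp

/-- The derivative of `t ↦ |t| ^ p` for `1 < p`. -/
noncomputable def absRpowDeriv (p t : ℝ) : ℝ :=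
  p * |t| ^ (p - 1) * if 0 ≤ t then 1 else -1

lemma abs_absRpowDeriv {p : ℝ} (hp : 0 ≤ p) (t : ℝ) :
    |absRpowDeriv p t| = p * |t| ^ (p - 1) := by
  have h : 0 ≤ p * |t| ^ (p - 1) := by positivity
  unfold absRpowDeriv
  split_ifs <;> simp [abs_of_nonneg hp, abs_of_nonneg (Real.rpow_nonneg (abs_nonneg t) (p - 1))]

lemma mul_absRpowDeriv_self {p : ℝ} (hp : 1 < p) (t : ℝ) :
    t * absRpowDeriv p t = p * |t| ^ p := by
  have h : |t| ^ p = |t| ^ (p - 1) * |t| := by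
    rw [← Real.rpow_add_one' (abs_nonneg t) (by linarith), sub_add_cancel]
  rw [h]
  unfold absRpowDeriv
  split_ifs with ht
  · rw [abs_of_nonneg ht]; ring
  · rw [abs_of_neg (not_le.1 ht)]; ring

lemma abs_mul_absRpowDeriv_le {p : ℝ} (hp : 1 < p) (s t : ℝ) :
    |s * absRpowDeriv p t| ≤ |s| ^ p + (p - 1) * |t| ^ p := by
  rw [abs_mul, abs_absRpowDeriv (by linarith)]
  linarith [mul_mul_rpow_sub_one_le hp (abs_nonneg s) (abs_nonneg t)]

/-- The Bregman divergence of `|·| ^ p` dominates the midpoint convexity defect. -/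
lemma midpoint_defect_le {p : ℝ} (hp : 1 < p) (a b : ℝ) :
    |a| ^ p + |b| ^ p - 2 * |(a + b) / 2| ^ p ≤
      |a| ^ p - |b| ^ p - (a * absRpowDeriv p b - b * absRpowDeriv p b) := by
  have h1 := le_of_abs_le (abs_mul_absRpowDeriv_le hp ((a + b) / 2) b)
  have h2 := mul_absRpowDeriv_self hp b
  linarith

/-- If `F_n ⇀ F` weakly in `L^{p(·)}(Ω)` and `ρ_{p(·)}(F_n) → ρ_{p(·)}(F)`, then
`ρ_{p(·)}(F_n − F) → 0`, i.e. `F_n → F` strongly in `L^{p(·)}(Ω)`. -/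
theorem strong_convergence_of_weak_and_modular_convergence
    {Ω : Type*} [MeasurableSpace Ω] (μ : Measure Ω)
    (p : Ω → ℝ) (hp : Measurable p) (p₁ p₂ : ℝ) (hp₁ : 1 < p₁)
    (hbd : ∀ᵐ x ∂μ, p₁ ≤ p x ∧ p x ≤ p₂)
    (F : Ω → ℝ) (hF : Measurable F)
    (hFfin : ∫⁻ x, ENNReal.ofReal (|F x| ^ p x) ∂μ < ⊤)
    (Fn : ℕ → Ω → ℝ) (hFn : ∀ n, Measurable (Fn n))
    (hFnfin : ∀ n, ∫⁻ x, ENNReal.ofReal (|Fn n x| ^ p x) ∂μ < ⊤)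
    (hweak : ∀ g : Ω → ℝ, Measurable g →
      ∫⁻ x, ENNReal.ofReal (|g x| ^ (p x / (p x - 1))) ∂μ < ⊤ →
      Tendsto (fun n => ∫ x, Fn n x * g x ∂μ) atTop (𝓝 (∫ x, F x * g x ∂μ)))
    (hmod : Tendsto (fun n => ∫⁻ x, ENNReal.ofReal (|Fn n x| ^ p x) ∂μ) atTop
      (𝓝 (∫⁻ x, ENNReal.ofReal (|F x| ^ p x) ∂μ))) :
    Tendsto (fun n => ∫⁻ x, ENNReal.ofReal (|Fn n x - F x| ^ p x) ∂μ) atTop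
      (𝓝 0) := by
  have hmeas : ∀ u : Ω → ℝ, Measurable u → Measurable fun x => |u x| ^ p x :=
    fun u hu => hu.abs.pow hp
  have hnn : ∀ u : Ω → ℝ, 0 ≤ᵐ[μ] fun x => |u x| ^ p x :=
    fun u => Eventually.of_forall fun x => Real.rpow_nonneg (abs_nonneg _) _
  have hint : ∀ u : Ω → ℝ, Measurable u → ∫⁻ x, ENNReal.ofReal (|u x| ^ p x) ∂μ < ⊤ →
      Integrable (fun x => |u x| ^ p x) μ := fun u hu h =>
    ⟨(hmeas u hu).aestronglyMeasurable, (hasFiniteIntegral_iff_ofReal (hnn u)).2 h⟩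
  have hA := fun n => hint (Fn n) (hFn n) (hFnfin n)
  have hB := hint F hF hFfin
  set g : Ω → ℝ := fun x => absRpowDeriv (p x) (F x) with hg
  have hgm : Measurable g :=
    (hp.mul (hF.abs.pow (hp.sub_const 1))).mul
      (Measurable.ite (measurableSet_le measurable_const hF) measurable_const measurable_const)
  have hgfin : ∫⁻ x, ENNReal.ofReal (|g x| ^ (p x / (p x - 1))) ∂μ < ⊤ := by
    refine lt_of_le_of_lt (lintegral_mono_ae ?_)
      ((hasFiniteIntegral_iff_ofReal ?_).1 (hB.const_mul (p₂ ^ (p₁ / (p₁ - 1)))).2)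
    · filter_upwards [hbd] with x hx
      have hpx : 1 < p x := lt_of_lt_of_le hp₁ hx.1
      have hpx1 : p x - 1 ≠ 0 := by linarith
      refine ENNReal.ofReal_le_ofReal ?_
      rw [hg, abs_absRpowDeriv (by linarith), Real.mul_rpow (by linarith)
        (Real.rpow_nonneg (abs_nonneg _) _), ← Real.rpow_mul (abs_nonneg _),
        mul_div_cancel₀ _ hpx1]
      refine mul_le_mul_of_nonneg_right ?_ (Real.rpow_nonneg (abs_nonneg _) _)
      calc p x ^ (p x / (p x - 1)) ≤ p₂ ^ (p x / (p x - 1)) :=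
            Real.rpow_le_rpow (by linarith) hx.2 (div_nonneg (by linarith) (by linarith))
        _ ≤ p₂ ^ (p₁ / (p₁ - 1)) := by
            refine Real.rpow_le_rpow_of_exponent_le (by linarith [hx.2]) ?_
            rw [div_le_div_iff₀ (by linarith) (by linarith)]
            nlinarith [hx.1]
    · filter_upwards [hbd] with x hx
      exact mul_nonneg (Real.rpow_nonneg (by linarith [hx.1, hx.2]) _)
        (Real.rpow_nonneg (abs_nonneg _) _)
  have hintg : ∀ u : Ω → ℝ, Measurable u → Integrable (fun x => |u x| ^ p x) μ →
      Integrable (fun x => u x * g x) μ := by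
    intro u hu h
    refine (h.add (hB.const_mul (p₂ - 1))).mono' (hu.mul hgm).aestronglyMeasurable ?_
    filter_upwards [hbd] with x hx
    refine (abs_mul_absRpowDeriv_le (lt_of_lt_of_le hp₁ hx.1) (u x) (F x)).trans ?_
    have := mul_le_mul_of_nonneg_right (sub_le_sub_right hx.2 1)
      (Real.rpow_nonneg (abs_nonneg (F x)) (p x))
    simpa using this
  have hmodR : Tendsto (fun n => ∫ x, |Fn n x| ^ p x ∂μ) atTop (𝓝 (∫ x, |F x| ^ p x ∂μ)) := by
    have heq : ∀ u : Ω → ℝ, Measurable u → ∫ x, |u x| ^ p x ∂μ =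
        (∫⁻ x, ENNReal.ofReal (|u x| ^ p x) ∂μ).toReal := fun u hu =>
      integral_eq_lintegral_of_nonneg_ae (hnn u) (hmeas u hu).aestronglyMeasurable
    simp only [heq _ (hFn _), heq _ hF]
    exact (ENNReal.tendsto_toReal hFfin.ne).comp hmod
  have hFg := hintg F hF hB
  have hFng := fun n => hintg (Fn n) (hFn n) (hA n)
  set I := ∫ x, |F x| ^ p x ∂μ with hI
  have hI0 : 0 ≤ I := integral_nonneg_of_ae (hnn F)
  rw [ENNReal.tendsto_nhds_zero]
  intro ε hε
  obtain ⟨δ, hδ0, hδε⟩ := ENNReal.lt_iff_exists_nnreal_btwn.1 hε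
  have hδ : (0 : ℝ) < δ := by exact_mod_cast hδ0
  obtain ⟨C, hC0, hC⟩ := exists_abs_sub_rpow_le (p₂ := p₂) hp₁
    (by positivity : (0 : ℝ) < δ / (2 * I + 1))
  set η : ℝ := δ / (2 * I + 1) with hη
  have hlim : Tendsto (fun n => η * (∫ x, |Fn n x| ^ p x ∂μ + I) +
      C * (∫ x, |Fn n x| ^ p x ∂μ - I - (∫ x, Fn n x * g x ∂μ - ∫ x, F x * g x ∂μ))) atTop
      (𝓝 (η * (I + I) + C * (I - I - (∫ x, F x * g x ∂μ - ∫ x, F x * g x ∂μ)))) :=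
    ((hmodR.add_const I).const_mul η).add
      (((hmodR.sub_const I).sub ((hweak g hgm hgfin).sub_const _)).const_mul C)
  have hlt : η * (I + I) + C * (I - I - (∫ x, F x * g x ∂μ - ∫ x, F x * g x ∂μ)) < δ := by
    have h : η * (2 * I + 1) = δ := div_mul_cancel₀ _ (by positivity)
    have hη0 : 0 < η := by positivity
    simp only [sub_self, mul_zero, add_zero]
    linarith
  filter_upwards [hlim.eventually_lt_const hlt] with n hn
  refine le_trans ?_ hδε.le
  have hsum : Integrable (fun x => |Fn n x| ^ p x + |F x| ^ p x) μ := (hA n).add hB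
  have hdiff : Integrable (fun x => |Fn n x| ^ p x - |F x| ^ p x) μ := (hA n).sub hB
  have hdual : Integrable (fun x => Fn n x * g x - F x * g x) μ := (hFng n).sub hFg
  have hbreg : Integrable (fun x => |Fn n x| ^ p x - |F x| ^ p x -
      (Fn n x * g x - F x * g x)) μ := hdiff.sub hdual
  have hbound : ∀ᵐ x ∂μ, |Fn n x - F x| ^ p x ≤ η * (|Fn n x| ^ p x + |F x| ^ p x) +
      C * (|Fn n x| ^ p x - |F x| ^ p x - (Fn n x * g x - F x * g x)) := by
    filter_upwards [hbd] with x hx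
    have h1 := hC (Fn n x) (F x) (p x) hx.1 hx.2
    have h2 := mul_le_mul_of_nonneg_left
      (midpoint_defect_le (lt_of_lt_of_le hp₁ hx.1) (Fn n x) (F x)) hC0
    exact h1.trans (by simpa [hg] using h2)
  calc ∫⁻ x, ENNReal.ofReal (|Fn n x - F x| ^ p x) ∂μ
      ≤ ∫⁻ x, ENNReal.ofReal (η * (|Fn n x| ^ p x + |F x| ^ p x) +
          C * (|Fn n x| ^ p x - |F x| ^ p x - (Fn n x * g x - F x * g x))) ∂μ :=
        lintegral_mono_ae (hbound.mono fun x hx => ENNReal.ofReal_le_ofReal hx)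
    _ = ENNReal.ofReal (∫ x, (η * (|Fn n x| ^ p x + |F x| ^ p x) +
          C * (|Fn n x| ^ p x - |F x| ^ p x - (Fn n x * g x - F x * g x))) ∂μ) :=
        (ofReal_integral_eq_lintegral_ofReal ((hsum.const_mul η).add (hbreg.const_mul C))
          (hbound.mono fun x hx => (Real.rpow_nonneg (abs_nonneg _) _).trans hx)).symm
    _ ≤ ENNReal.ofReal δ := by
        refine ENNReal.ofReal_le_ofReal ?_
        rw [integral_add (hsum.const_mul η) (hbreg.const_mul C), integral_const_mul,
          integral_const_mul, integral_add (hA n) hB, integral_sub hdiff hdual,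
          integral_sub (hA n) hB, integral_sub (hFng n) hFg]
        exact hn.le
    _ = δ := ENNReal.ofReal_coe_nnreal
end

section
/- For every real p with 1 < p < 2 there exists a constant C > 0 such that for all vectors η, ξ ∈ ℝ^N with (η, ξ) ≠ (0, 0): |η − ξ|² (|η| + |ξ|)^{p−2} ≤ C (|η|^{p−2} η − |ξ|^{p−2} ξ) · (η − ξ), where · denotes the Euclidean inner product and |·| the Euclidean norm, with the convention |0|^{p−2}·0 = 0. -/
open scoped RealInnerProductSpace

/-- The tangent-line bound for the concave function `x ↦ x ^ (p - 1)` on `(0, ∞)`. -/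
lemma Real.sub_one_mul_rpow_mul_sub_le {p a b : ℝ} (hp₁ : 1 ≤ p) (hp₂ : p ≤ 2)
    (ha : 0 < a) (hb : 0 < b) :
    (p - 1) * a ^ (p - 2) * (a - b) ≤ a ^ (p - 2) * a - b ^ (p - 2) * b := by
  have bernoulli : (b / a) ^ (p - 1) ≤ 1 + (p - 1) * (b / a - 1) := by
    have hba : 0 < b / a := div_pos hb ha
    have h := rpow_one_add_le_one_add_mul_self (s := b / a - 1) (p := p - 1)
      (by linarith) (by linarith) (by linarith)
    rwa [add_sub_cancel] at h
  have rpow_eq : ∀ x : ℝ, 0 < x → x ^ (p - 2) * x = x ^ (p - 1) := fun x hx => by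
    rw [← Real.rpow_add_one hx.ne']
    congr 1
    ring
  rw [Real.div_rpow hb.le ha.le, div_le_iff₀ (Real.rpow_pos_of_pos ha _),
    ← rpow_eq a ha, ← rpow_eq b hb] at bernoulli
  have expand : (1 + (p - 1) * (b / a - 1)) * (a ^ (p - 2) * a) =
      a ^ (p - 2) * a - (p - 1) * a ^ (p - 2) * (a - b) := by
    field_simp
    ring
  linarith

section

variable {E : Type*} [NormedAddCommGroup E] [InnerProductSpace ℝ E]

lemma inner_smul_sub_smul_sub (x y : E) (a b : ℝ) :
    ⟪a • x - b • y, x - y⟫ = a * ‖x‖ ^ 2 + b * ‖y‖ ^ 2 - (a + b) * ⟪x, y⟫ := by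
  simp only [inner_sub_left, inner_sub_right, real_inner_smul_left,
    real_inner_self_eq_norm_sq, real_inner_comm x y]
  ring

/-- Strong monotonicity of `x ↦ ‖x‖ ^ (p - 2) • x` for `1 ≤ p ≤ 2`, with constant `p - 1`,
for vectors ordered by their norms. -/
lemma sub_one_mul_norm_sub_sq_mul_rpow_le_inner_of_norm_le {p : ℝ} (hp₁ : 1 ≤ p) (hp₂ : p ≤ 2)
    {x y : E} (hx : x ≠ 0) (hyx : ‖y‖ ≤ ‖x‖) :
    (p - 1) * (‖x - y‖ ^ 2 * (‖x‖ + ‖y‖) ^ (p - 2)) ≤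
      ⟪(‖x‖ ^ (p - 2)) • x - (‖y‖ ^ (p - 2)) • y, x - y⟫ := by
  have hx' : 0 < ‖x‖ := norm_pos_iff.mpr hx
  rw [inner_smul_sub_smul_sub, norm_sub_sq_real]
  rcases eq_or_ne y 0 with rfl | hy
  · have hpos : 0 ≤ ‖x‖ ^ 2 * ‖x‖ ^ (p - 2) := by positivity
    simp only [norm_zero, inner_zero_right, add_zero]
    nlinarith
  have hy' : 0 < ‖y‖ := norm_pos_iff.mpr hy
  have hcs := real_inner_le_norm x y
  have tangent := Real.sub_one_mul_rpow_mul_sub_le hp₁ hp₂ hx' hy'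
  have hSx : (‖x‖ + ‖y‖) ^ (p - 2) ≤ ‖x‖ ^ (p - 2) :=
    Real.rpow_le_rpow_of_nonpos hx' (by linarith) (by linarith)
  have hSy : (‖x‖ + ‖y‖) ^ (p - 2) ≤ ‖y‖ ^ (p - 2) :=
    Real.rpow_le_rpow_of_nonpos hy' (by linarith) (by linarith)
  have hS : 0 ≤ (‖x‖ + ‖y‖) ^ (p - 2) := by positivity
  generalize (‖x‖ + ‖y‖) ^ (p - 2) = S at *
  generalize ‖x‖ ^ (p - 2) = A at *
  generalize ‖y‖ ^ (p - 2) = B at *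
  have radial : (p - 1) * S * (‖x‖ - ‖y‖) * (‖x‖ - ‖y‖) ≤
      (A * ‖x‖ - B * ‖y‖) * (‖x‖ - ‖y‖) := by
    refine mul_le_mul_of_nonneg_right (le_trans ?_ tangent) (sub_nonneg.mpr hyx)
    exact mul_le_mul_of_nonneg_right (mul_le_mul_of_nonneg_left hSx (by linarith))
      (sub_nonneg.mpr hyx)
  have angular : 2 * ((p - 1) * S) * (‖x‖ * ‖y‖ - ⟪x, y⟫) ≤
      (A + B) * (‖x‖ * ‖y‖ - ⟪x, y⟫) :=
    mul_le_mul_of_nonneg_right (by nlinarith) (sub_nonneg.mpr hcs)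
  linear_combination radial + angular

lemma sub_one_mul_norm_sub_sq_mul_rpow_le_inner {p : ℝ} (hp₁ : 1 ≤ p) (hp₂ : p ≤ 2)
    {x y : E} (hxy : ¬(x = 0 ∧ y = 0)) :
    (p - 1) * (‖x - y‖ ^ 2 * (‖x‖ + ‖y‖) ^ (p - 2)) ≤
      ⟪(‖x‖ ^ (p - 2)) • x - (‖y‖ ^ (p - 2)) • y, x - y⟫ := by
  wlog hyx : ‖y‖ ≤ ‖x‖ generalizing x y
  · have h := this (fun h => hxy h.symm) (le_of_not_ge hyx)
    rwa [norm_sub_rev, add_comm, ← inner_neg_neg, neg_sub, neg_sub] at h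
  refine sub_one_mul_norm_sub_sq_mul_rpow_le_inner_of_norm_le hp₁ hp₂ ?_ hyx
  rintro rfl
  exact hxy ⟨rfl, by simpa using hyx⟩

end

/-- Monotonicity inequality for the `p`-Laplacian vector field `η ↦ |η|^{p−2}η`
on `ℝ^N` in the singular range `1 < p < 2`. -/
theorem pLaplacian_monotonicity_singular (N : ℕ) (p : ℝ) (hp₁ : 1 < p)
    (hp₂ : p < 2) :
    ∃ C : ℝ, 0 < C ∧ ∀ η ξ : EuclideanSpace ℝ (Fin N), ¬(η = 0 ∧ ξ = 0) →
      ‖η - ξ‖ ^ 2 * (‖η‖ + ‖ξ‖) ^ (p - 2) ≤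
        C * ⟪(‖η‖ ^ (p - 2)) • η - (‖ξ‖ ^ (p - 2)) • ξ, η - ξ⟫ := by
  have hp : 0 < p - 1 := sub_pos.mpr hp₁
  refine ⟨(p - 1)⁻¹, inv_pos.mpr hp, fun η ξ h => ?_⟩
  rw [le_inv_mul_iff₀ hp]
  exact sub_one_mul_norm_sub_sq_mul_rpow_le_inner hp₁.le hp₂.le h
end

section
/- Let (Ω, μ) be a measure space with μ(Ω) < ∞, let p : Ω → ℝ be measurable with 1 < p₁ ≤ p(x) ≤ 2 for a.e. x ∈ Ω (p₁ a constant), and let H₀ be a finite-dimensional subspace of L²(Ω, μ). Then the functional F(q) := ∫_Ω |q(x)|^{p(x)} dμ(x) is coercive relative to the L² norm on H₀: for every M > 0 there exists R > 0 such that every q ∈ H₀ with ‖q‖_{L²(Ω)} ≥ R satisfies F(q) ≥ M ‖q‖_{L²(Ω)}; equivalently, F(q)/‖q‖_{L²(Ω)} → ∞ as ‖q‖_{L²(Ω)} → ∞ with q ∈ H₀. -/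
open MeasureTheory

/-- On a finite measure space, the inclusion of `L²` into `L¹`. -/
noncomputable def lpTwoToLpOne {Ω : Type*} [MeasurableSpace Ω] (μ : Measure Ω)
    [IsFiniteMeasure μ] : Lp ℝ 2 μ →ₗ[ℝ] Lp ℝ 1 μ where
  toFun f := ⟨f.1, Lp.antitone one_le_two f.2⟩
  map_add' _ _ := rfl
  map_smul' _ _ := rfl

theorem lpTwoToLpOne_injective {Ω : Type*} [MeasurableSpace Ω] (μ : Measure Ω)
    [IsFiniteMeasure μ] : Function.Injective (lpTwoToLpOne μ) := fun _ _ h =>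
  Subtype.ext (congrArg (fun g : Lp ℝ 1 μ => (g : Ω →ₘ[μ] ℝ)) h)

/-- On a finite-dimensional subspace of `L²`, the `L²` norm is controlled by the `L¹` norm. -/
theorem exists_mul_norm_le_integral_abs {Ω : Type*} [MeasurableSpace Ω] (μ : Measure Ω)
    [IsFiniteMeasure μ] (H₀ : Submodule ℝ (Lp ℝ 2 μ)) [FiniteDimensional ℝ H₀] :
    ∃ c : ℝ, 0 < c ∧ ∀ q ∈ H₀, c * ‖q‖ ≤ ∫ x, |q x| ∂μ := by
  obtain ⟨K, hK, hanti⟩ := LinearMap.exists_antilipschitzWith ((lpTwoToLpOne μ).domRestrict H₀)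
    (LinearMap.ker_eq_bot.2 ((lpTwoToLpOne_injective μ).comp Subtype.val_injective))
  refine ⟨(K : ℝ)⁻¹, by positivity, fun q hq => ?_⟩
  have h := hanti.le_mul_dist ⟨q, hq⟩ 0
  rw [map_zero, dist_zero_right, dist_zero_right, L1.norm_eq_integral_norm] at h
  rw [inv_mul_le_iff₀ (by positivity)]
  exact h

/-- A superlinear power dominates an affine function of arbitrarily large slope. -/
theorem rpow_mul_sub_le_rpow {p₁ p T t : ℝ} (hp₁ : 1 < p₁) (hp : p₁ ≤ p) (hT : 1 ≤ T)
    (ht : 0 ≤ t) : T ^ (p₁ - 1) * (t - T) ≤ t ^ p := by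
  rcases le_total t T with h | h
  · exact (mul_nonpos_of_nonneg_of_nonpos (by positivity) (by linarith)).trans (by positivity)
  · have ht0 : 0 < t := by linarith
    calc T ^ (p₁ - 1) * (t - T) ≤ t ^ (p₁ - 1) * t := by
          gcongr; linarith
      _ = t ^ p₁ := by
          rw [← Real.rpow_add_one ht0.ne', sub_add_cancel]
      _ ≤ t ^ p := Real.rpow_le_rpow_of_exponent_le (hT.trans h) hp

/-- An `L²` function is integrable to any variable power with exponents in `[0, 2]`. -/
theorem MeasureTheory.MemLp.integrable_abs_rpow_of_le_two {Ω : Type*} [MeasurableSpace Ω]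
    {μ : Measure Ω} [IsFiniteMeasure μ] {f p : Ω → ℝ} (hf : MemLp f 2 μ)
    (hp : AEMeasurable p μ) (hbd : ∀ᵐ x ∂μ, 0 ≤ p x ∧ p x ≤ 2) :
    Integrable (fun x => |f x| ^ p x) μ := by
  refine ((integrable_const (1 : ℝ)).add hf.integrable_sq).mono'
    (hf.1.aemeasurable.abs.pow hp).aestronglyMeasurable ?_
  filter_upwards [hbd] with x ⟨h0, h2⟩
  rw [Real.norm_of_nonneg (by positivity), Pi.add_apply]
  rcases le_total |f x| 1 with h | h
  · exact (Real.rpow_le_one (abs_nonneg _) h h0).trans (by nlinarith [sq_nonneg (f x)])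
  · have := Real.rpow_le_rpow_of_exponent_le h h2
    rw [Real.rpow_two, sq_abs] at this
    linarith

/-- On a finite measure space with `1 < p₁ ≤ p(x) ≤ 2` a.e., the functional
`F(q) = ∫ |q|^{p(x)} dμ` is coercive relative to the `L²` norm on any
finite-dimensional subspace `H₀` of `L²(Ω, μ)`. -/
theorem modular_functional_coercive_on_finite_dimensional_subspace
    {Ω : Type*} [MeasurableSpace Ω] (μ : Measure Ω) [IsFiniteMeasure μ]
    (p : Ω → ℝ) (hp : Measurable p) (p₁ : ℝ) (hp₁ : 1 < p₁)
    (hbd : ∀ᵐ x ∂μ, p₁ ≤ p x ∧ p x ≤ 2)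
    (H₀ : Submodule ℝ (Lp ℝ 2 μ)) (hH₀ : FiniteDimensional ℝ H₀) :
    ∀ M : ℝ, 0 < M → ∃ R : ℝ, 0 < R ∧ ∀ q : Lp ℝ 2 μ, q ∈ H₀ → R ≤ ‖q‖ →
      M * ‖q‖ ≤ ∫ x, |q x| ^ p x ∂μ := by
  intro M hM
  obtain ⟨c, hc, hcoer⟩ := exists_mul_norm_le_integral_abs μ H₀
  obtain ⟨T, hT1, hTM⟩ : ∃ T : ℝ, 1 ≤ T ∧ 2 * M / c ≤ T ^ (p₁ - 1) :=
    ((Filter.eventually_ge_atTop 1).and ((tendsto_rpow_atTop (sub_pos.2 hp₁)).eventually_ge_atTop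
      (2 * M / c))).exists
  set K := T ^ (p₁ - 1)
  have hK : 0 ≤ K := by positivity
  refine ⟨K * (T * μ.real Set.univ) / M + 1, by positivity, fun q hq hR => ?_⟩
  have hq1 : Integrable (fun x => |q x|) μ := ((Lp.memLp q).integrable one_le_two).abs
  have hF : ∫ x, K * (|q x| - T) ∂μ ≤ ∫ x, |q x| ^ p x ∂μ := by
    refine integral_mono_ae ((hq1.sub (integrable_const T)).const_mul K)
      ((Lp.memLp q).integrable_abs_rpow_of_le_two hp.aemeasurable ?_) ?_
    · filter_upwards [hbd] with x hx using ⟨by linarith, hx.2⟩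
    · filter_upwards [hbd] with x hx using rpow_mul_sub_le_rpow hp₁ hx.1 hT1 (abs_nonneg _)
  rw [integral_const_mul, integral_sub hq1 (integrable_const T), integral_const, smul_eq_mul,
    mul_comm _ T, mul_sub] at hF
  have h1 : 2 * M * ‖q‖ ≤ K * ∫ x, |q x| ∂μ :=
    calc 2 * M * ‖q‖ ≤ K * c * ‖q‖ :=
          mul_le_mul_of_nonneg_right ((div_le_iff₀ hc).1 hTM) (norm_nonneg q)
      _ = K * (c * ‖q‖) := mul_assoc _ _ _
      _ ≤ K * ∫ x, |q x| ∂μ := by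
          gcongr
          exact hcoer q hq
  have h2 : K * (T * μ.real Set.univ) ≤ ‖q‖ * M := (div_le_iff₀ hM).1 (by linarith)
  linarith
end
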